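/- (Lemma 2.4) Under the holonomic system hypotheses with the conformally flat constant-mean-curvature ansatz, define α1 := (1/v2) ∂v2/∂u1, α2 := (1/v3) ∂v3/∂u2, α3 := (1/v1) ∂v1/∂u3. Then there is no nonempty open subset of U on which v1 - v3 is nowhere vanishing and α1 = 0 = α3 identically. -/

import Mathlib

noncomputable section

/-- Partial derivative of `f : ℝ³ → ℝ` in the `i`-th coordinate direction `u_{i+1}`. -/
noncomputable def pd (i : Fin 3) (f : (Fin 3 → ℝ) → ℝ) (p : Fin 3 → ℝ) : ℝ :=
  fderiv ℝ f p (Pi.single i 1)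

/-- `hh v i j p = h_{ij}(p) = (1/v_i) ∂v_j/∂u_i` (indices shifted down by one:
`v 0, v 1, v 2` are `v₁, v₂, v₃` and directions `0,1,2` are `u₁,u₂,u₃`). -/
noncomputable def hh (v : Fin 3 → (Fin 3 → ℝ) → ℝ) (i j : Fin 3) (p : Fin 3 → ℝ) : ℝ :=
  (1 / v i p) * pd i (v j) p

/-- `al v 0 = α₁ = (1/v₂)∂v₂/∂u₁`, `al v 1 = α₂ = (1/v₃)∂v₃/∂u₂`,
`al v 2 = α₃ = (1/v₁)∂v₁/∂u₃`. -/
noncomputable def al (v : Fin 3 → (Fin 3 → ℝ) → ℝ) (i : Fin 3) (p : Fin 3 → ℝ) : ℝ :=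
  (1 / v (i + 1) p) * pd i (v (i + 1)) p

/-- The holonomic system hypotheses together with the conformally flat
constant-mean-curvature ansatz, on a connected open set `U ⊆ ℝ³`. -/
structure Hypo (U : Set (Fin 3 → ℝ)) (v V : Fin 3 → (Fin 3 → ℝ) → ℝ) (c H : ℝ) : Prop where
  hopen : IsOpen U
  hconn : IsConnected U
  smooth_v : ∀ i, ContDiffOn ℝ (⊤ : ℕ∞) (v i) U
  smooth_V : ∀ i, ContDiffOn ℝ (⊤ : ℕ∞) (V i) U
  pos : ∀ i, ∀ p ∈ U, 0 < v i p
  holi : ∀ i j, i ≠ j → ∀ p ∈ U, pd j (v i) p = hh v j i p * v j p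
  holii : ∀ i j k, i ≠ j → j ≠ k → i ≠ k → ∀ p ∈ U,
    pd j (hh v i k) p = hh v i j p * hh v j k p
  holiii : ∀ i j k, i ≠ j → j ≠ k → i ≠ k → ∀ p ∈ U,
    pd i (hh v i j) p + pd j (hh v j i) p + hh v k i p * hh v k j p
      + V i p * V j p + c * v i p * v j p = 0
  holiv : ∀ i j, i ≠ j → ∀ p ∈ U, pd j (V i) p = hh v j i p * V j p
  ansatz_v : ∀ p ∈ U, (v 1 p) ^ 2 = (v 0 p) ^ 2 + (v 2 p) ^ 2
  ansatz_V1 : ∀ p ∈ U, V 0 p = -(1/3) * (v 1 p / v 2 p + v 2 p / v 1 p) + (v 0 p / 3) * H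
  ansatz_V2 : ∀ p ∈ U, V 1 p = -(1/3) * (v 0 p / v 2 p - v 2 p / v 0 p) + (v 1 p / 3) * H
  ansatz_V3 : ∀ p ∈ U, V 2 p = (1/3) * (v 0 p / v 1 p + v 1 p / v 0 p) + (v 2 p / 3) * H

open Filter Topology

lemma hasDerivAt_line {f : (Fin 3 → ℝ) → ℝ} {p : Fin 3 → ℝ} {j : Fin 3} {t : ℝ}
    (hf : DifferentiableAt ℝ f (p + t • Pi.single j 1)) :
    HasDerivAt (fun s : ℝ => f (p + s • Pi.single j 1)) (pd j f (p + t • Pi.single j 1)) t := by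
  have h : HasDerivAt (fun s : ℝ => p + s • (Pi.single j 1 : Fin 3 → ℝ)) (Pi.single j 1) t := by
    simpa using ((hasDerivAt_id t).smul_const (Pi.single j 1 : Fin 3 → ℝ)).const_add p
  exact hf.hasFDerivAt.comp_hasDerivAt t h

lemma hasDerivAt_line_zero {f : (Fin 3 → ℝ) → ℝ} {p : Fin 3 → ℝ} (j : Fin 3)
    (hf : DifferentiableAt ℝ f p) :
    HasDerivAt (fun s : ℝ => f (p + s • Pi.single j 1)) (pd j f p) 0 := by
  simpa using hasDerivAt_line (f := f) (p := p) (j := j) (t := 0) (by simpa using hf)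

lemma eventually_line {P : (Fin 3 → ℝ) → Prop} {p : Fin 3 → ℝ} (j : Fin 3)
    (h : ∀ᶠ q in 𝓝 p, P q) : ∀ᶠ s : ℝ in 𝓝 0, P (p + s • Pi.single j 1) := by
  have hc : Continuous (fun s : ℝ => p + s • (Pi.single j 1 : Fin 3 → ℝ)) := by fun_prop
  have := hc.tendsto 0
  simp only [zero_smul, add_zero] at this
  exact this.eventually h

lemma pd_eq_zero_of_eventually {f : (Fin 3 → ℝ) → ℝ} {p : Fin 3 → ℝ} (j : Fin 3)
    (h : ∀ᶠ q in 𝓝 p, f q = 0) : pd j f p = 0 := by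
  have h' : f =ᶠ[𝓝 p] fun _ => 0 := h
  simp [pd, h'.fderiv_eq]

lemma pd_sq_add_sq {a b d : (Fin 3 → ℝ) → ℝ} {p : Fin 3 → ℝ} (j : Fin 3)
    (ha : DifferentiableAt ℝ a p) (hb : DifferentiableAt ℝ b p) (hd : DifferentiableAt ℝ d p)
    (h : ∀ᶠ q in 𝓝 p, b q ^ 2 = a q ^ 2 + d q ^ 2) :
    b p * pd j b p = a p * pd j a p + d p * pd j d p := by
  have e := ((hasDerivAt_line_zero j hb).fun_pow 2).unique
    ((((hasDerivAt_line_zero j ha).fun_pow 2).fun_add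
      ((hasDerivAt_line_zero j hd).fun_pow 2)).congr_of_eventuallyEq (eventually_line j h))
  simp at e
  linarith

/-- Differentiating `3xyV = εx² + δy² + Hxyz` in a coordinate direction. -/
lemma pd_curvature {x y z V : (Fin 3 → ℝ) → ℝ} {p : Fin 3 → ℝ} {ε δ H : ℝ} (j : Fin 3)
    (hx : DifferentiableAt ℝ x p) (hy : DifferentiableAt ℝ y p) (hz : DifferentiableAt ℝ z p)
    (hV : DifferentiableAt ℝ V p)
    (h : ∀ᶠ q in 𝓝 p, 3 * (x q * y q) * V q
      = ε * x q ^ 2 + δ * y q ^ 2 + H * (x q * y q * z q)) :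
    3 * (pd j x p * y p + x p * pd j y p) * V p + 3 * (x p * y p) * pd j V p
      = 2 * ε * x p * pd j x p + 2 * δ * y p * pd j y p
        + H * ((pd j x p * y p + x p * pd j y p) * z p + x p * y p * pd j z p) := by
  have dx := hasDerivAt_line_zero j hx
  have dy := hasDerivAt_line_zero j hy
  have dz := hasDerivAt_line_zero j hz
  have dV := hasDerivAt_line_zero j hV
  have e := (((dx.fun_mul dy).const_mul 3).fun_mul dV).unique
    (((((dx.fun_pow 2).const_mul ε).fun_add ((dy.fun_pow 2).const_mul δ)).fun_add
      (((dx.fun_mul dy).fun_mul dz).const_mul H)).congr_of_eventuallyEq (eventually_line j h))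
  simp at e
  linarith

section Algebra

variable {a b d a' b' d' H V₀ V₁ V₀' V₁' : ℝ}

lemma derivs_eq_zero_of_middle (ha : 0 < a) (hd : 0 < d)
    (hs : b * b' = a * a' + d * d') (hb' : b' = 0) (hV' : V₁' = 0)
    (hV : 3 * (a * d) * V₁ = -1 * a ^ 2 + 1 * d ^ 2 + H * (a * d * b))
    (h : 3 * (a' * d + a * d') * V₁ + 3 * (a * d) * V₁'
      = 2 * (-1) * a * a' + 2 * 1 * d * d' + H * ((a' * d + a * d') * b + a * d * b')) :
    a' = 0 ∧ d' = 0 := by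
  subst hb' hV'
  have e : (a ^ 2 + d ^ 2) * (a' * d - a * d') = 0 := by
    linear_combination (a * d) * h - (a' * d + a * d') * hV
  have e' : a' * d - a * d' = 0 := (mul_eq_zero.mp e).resolve_left (by positivity)
  have e2 : (a ^ 2 + d ^ 2) * a' = 0 := by linear_combination (-a) * hs + d * e'
  have ha' : a' = 0 := (mul_eq_zero.mp e2).resolve_left (by positivity)
  subst ha'
  refine ⟨rfl, ?_⟩
  have : a * d' = 0 := by linarith
  exact (mul_eq_zero.mp this).resolve_left ha.ne'

lemma derivs_eq_zero_of_first (ha : 0 < a) (hb : 0 < b) (hsq : b ^ 2 = a ^ 2 + d ^ 2)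
    (hs : b * b' = a * a' + d * d') (ha' : a' = 0) (hV' : V₀' = 0)
    (hV : 3 * (b * d) * V₀ = -1 * b ^ 2 + -1 * d ^ 2 + H * (b * d * a))
    (h : 3 * (b' * d + b * d') * V₀ + 3 * (b * d) * V₀'
      = 2 * (-1) * b * b' + 2 * (-1) * d * d'
        + H * ((b' * d + b * d') * a + b * d * a')) :
    b' = 0 ∧ d' = 0 := by
  subst ha' hV'
  have e : a ^ 2 * (b' * d - b * d') = 0 := by
    linear_combination (b * d) * h - (b' * d + b * d') * hV - (b' * d - b * d') * hsq
  have e' : b' * d - b * d' = 0 := (mul_eq_zero.mp e).resolve_left (by positivity)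
  have e2 : a ^ 2 * b' = 0 := by linear_combination b * hs - d * e' - b' * hsq
  have hb' : b' = 0 := (mul_eq_zero.mp e2).resolve_left (by positivity)
  subst hb'
  refine ⟨rfl, ?_⟩
  have : b * d' = 0 := by linarith
  exact (mul_eq_zero.mp this).resolve_left hb.ne'

lemma pow_five_mul_deriv (hsq : b ^ 2 = a ^ 2 + d ^ 2)
    (hs : b * b' = a * a' + d * d') (hV' : b * V₀' = a' * V₁)
    (hV₀ : 3 * (b * d) * V₀ = -1 * b ^ 2 + -1 * d ^ 2 + H * (b * d * a))
    (hV₁ : 3 * (a * d) * V₁ = -1 * a ^ 2 + 1 * d ^ 2 + H * (a * d * b))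
    (h : 3 * (b' * d + b * d') * V₀ + 3 * (b * d) * V₀'
      = 2 * (-1) * b * b' + 2 * (-1) * d * d'
        + H * ((b' * d + b * d') * a + b * d * a')) :
    a ^ 5 * d' = d ^ 5 * a' := by
  have e2 : a ^ 3 * (b' * d - b * d') = a' * b * d * (a ^ 2 - d ^ 2) := by
    linear_combination (a * b * d) * h - a * (b' * d + b * d') * hV₀
      - a * (b' * d - b * d') * hsq - 3 * a * d * b * d * hV' - d * b * a' * hV₁
  have e3 : b * (b' * d - b * d') = a * (d * a' - a * d') := by
    linear_combination d * hs - d' * hsq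
  linear_combination (-b) * e2 + a ^ 3 * e3 - a' * d * (a ^ 2 - d ^ 2) * hsq

lemma not_products_eq {a b d m p₁ p₂ p₃ c H : ℝ} (ha : 0 < a) (hb : 0 < b) (hd : 0 < d)
    (hsq : b ^ 2 = a ^ 2 + d ^ 2)
    (h₁ : p₁ = H * m - b ^ 2 - d ^ 2) (h₂ : p₂ = H * m - a ^ 2 + d ^ 2)
    (h₃ : p₃ = H * m + a ^ 2 + b ^ 2)
    (h₁₂ : p₁ * p₂ + 9 * c * m ^ 2 = 0) (h₁₃ : p₁ * p₃ + 9 * c * m ^ 2 = 0)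
    (h₂₃ : p₂ * p₃ + 9 * c * m ^ 2 = 0) : False := by
  have e₁ : a ^ 2 * p₁ = 0 := by
    have : p₃ - p₂ = 3 * a ^ 2 := by linear_combination h₃ - h₂ + hsq
    linear_combination (h₁₃ - h₁₂) / 3 - p₁ / 3 * this
  have e₃ : d ^ 2 * p₃ = 0 := by
    have : p₂ - p₁ = 3 * d ^ 2 := by linear_combination h₂ - h₁ + hsq
    linear_combination (h₂₃ - h₁₃) / 3 - p₃ / 3 * this
  have f₁ := (mul_eq_zero.mp e₁).resolve_left (by positivity)
  have f₃ := (mul_eq_zero.mp e₃).resolve_left (by positivity)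
  nlinarith [pow_pos hb 2]

/-- The Gauss equations of the reduced system, after elimination of the second derivatives. -/
lemma gauss_elimination {a b d m p₁ p₂ p₃ c H β β' T₁ T₃ : ℝ} (ha : 0 < a) (hb : 0 < b)
    (hd : 0 < d) (hsq : b ^ 2 = a ^ 2 + d ^ 2) (hm : m = a * b * d)
    (h₁ : p₁ = H * m - b ^ 2 - d ^ 2) (h₂ : p₂ = H * m - a ^ 2 + d ^ 2)
    (h₃ : p₃ = H * m + a ^ 2 + b ^ 2)
    (hT₁ : b ^ 3 * T₁ = β' * a ^ 5 * b ^ 2 + 5 * β ^ 2 * a ^ 9 * b ^ 2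
      - β ^ 2 * a ^ 5 * (a ^ 6 + d ^ 6))
    (hT₃ : b ^ 3 * T₃ = β' * d ^ 5 * b ^ 2 + 5 * β ^ 2 * d ^ 9 * b ^ 2
      - β ^ 2 * d ^ 5 * (a ^ 6 + d ^ 6))
    (h₁₂ : 9 * a * b * d ^ 2 * T₁ + p₁ * p₂ + 9 * c * m ^ 2 = 0)
    (h₁₃ : 9 * β ^ 2 * a ^ 6 * d ^ 6 + p₁ * p₃ + 9 * c * m ^ 2 = 0)
    (h₂₃ : 9 * a ^ 2 * b * d * T₃ + p₂ * p₃ + 9 * c * m ^ 2 = 0) :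
    (2 * H ^ 2 + 18 * c) * ((a ^ 2 - d ^ 2) * a ^ 2 * d ^ 2 * (a ^ 2 + d ^ 2))
      + H * (a * b * d) * (2 * a ^ 4 - 3 * a ^ 2 * d ^ 2 + 2 * d ^ 4)
      - 4 * (a ^ 2 - d ^ 2) * (a ^ 2 + d ^ 2) ^ 2 = 0 := by
  have e : b * (d ^ 5 * T₁ - a ^ 5 * T₃) = 5 * β ^ 2 * a ^ 5 * d ^ 5 * (a ^ 4 - d ^ 4) := by
    refine mul_left_cancel₀ (pow_ne_zero 2 hb.ne') ?_
    linear_combination d ^ 5 * hT₁ - a ^ 5 * hT₃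
  have e' : 6 * (a ^ 4 - d ^ 4) * (9 * c * m ^ 2) + 5 * (a ^ 4 - d ^ 4) * (p₁ * p₃)
      - d ^ 4 * (p₁ * p₂) + a ^ 4 * (p₂ * p₃) = 0 := by
    linear_combination 9 * a * d * e - d ^ 4 * h₁₂ + a ^ 4 * h₂₃ + 5 * (a ^ 4 - d ^ 4) * h₁₃
  rw [hsq] at h₁ h₃
  have hm2 : m ^ 2 = a ^ 2 * d ^ 2 * (a ^ 2 + d ^ 2) := by rw [hm, ← hsq]; ring
  rw [← hm]
  subst h₁ h₂ h₃
  refine (mul_eq_zero.mp (?_ : 3 * (a ^ 2 + d ^ 2) * _ = 0)).resolve_left (by positivity)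
  linear_combination e' - 6 * (a ^ 4 - d ^ 4) * (H ^ 2 + 9 * c) * hm2

end Algebra

/-- The reduced ordinary differential system is incompatible with the algebraic relation
supplied by the Gauss equations, unless the solution is constant. -/
lemma no_nonconstant_reduced_solution {S : Set ℝ} (hS : IsOpen S) {t : ℝ} (ht : t ∈ S)
    {a b d β : ℝ → ℝ} {C H : ℝ}
    (ha : ∀ s ∈ S, 0 < a s) (hb : ∀ s ∈ S, 0 < b s) (hd : ∀ s ∈ S, 0 < d s)
    (hβ : ∀ s ∈ S, β s ≠ 0) (hne : ∀ s ∈ S, a s - d s ≠ 0)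
    (hsq : ∀ s ∈ S, b s ^ 2 = a s ^ 2 + d s ^ 2)
    (da : ∀ s ∈ S, HasDerivAt a (β s * a s ^ 5) s)
    (db : ∀ s ∈ S, HasDerivAt b (β s * (a s ^ 6 + d s ^ 6) / b s) s)
    (dd : ∀ s ∈ S, HasDerivAt d (β s * d s ^ 5) s)
    (hF : ∀ s ∈ S, C * ((a s ^ 2 - d s ^ 2) * a s ^ 2 * d s ^ 2 * (a s ^ 2 + d s ^ 2))
      + H * (a s * b s * d s) * (2 * a s ^ 4 - 3 * a s ^ 2 * d s ^ 2 + 2 * d s ^ 4)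
      - 4 * (a s ^ 2 - d s ^ 2) * (a s ^ 2 + d s ^ 2) ^ 2 = 0) : False := by
  have key : ∀ s ∈ S, ∀ {f : ℝ → ℝ} {f' : ℝ}, (∀ r ∈ S, f r = 0) → HasDerivAt f f' s →
      f' = 0 := by
    intro s hs f f' h0 hf
    have : f =ᶠ[𝓝 s] fun _ => (0 : ℝ) := by
      filter_upwards [hS.mem_nhds hs] with r hr using h0 r hr
    exact hf.unique ((hasDerivAt_const s (0 : ℝ)).congr_of_eventuallyEq this)
  have hE : ∀ s ∈ S, H * (a s * d s) * (4 * a s ^ 4 - 13 * (a s ^ 2 * d s ^ 2) + 4 * d s ^ 4)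
      + 8 * b s * (a s ^ 4 - d s ^ 4) = 0 := by
    intro s hs
    have a2 := (da s hs).fun_pow 2
    have d2 := (dd s hs).fun_pow 2
    have e := key s hs hF
      ((((((((a2.fun_sub d2).fun_mul a2).fun_mul d2).fun_mul (a2.fun_add d2)).const_mul C).fun_add
        (((((da s hs).fun_mul (db s hs)).fun_mul (dd s hs)).const_mul H).fun_mul
          (((((da s hs).fun_pow 4).const_mul 2).fun_sub ((a2.const_mul 3).fun_mul d2)).fun_add
            (((dd s hs).fun_pow 4).const_mul 2)))).fun_sub
        (((a2.fun_sub d2).const_mul 4).fun_mul ((a2.fun_add d2).fun_pow 2))))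
    have hF := hF s hs
    have hsq := hsq s hs
    have hb := hb s hs
    have ha := ha s hs
    have hd := hd s hs
    have hβ := hβ s hs
    have hw : b s * (β s * (a s ^ 6 + d s ^ 6) / b s) = β s * (a s ^ 6 + d s ^ 6) := by
      field_simp
    generalize β s * (a s ^ 6 + d s ^ 6) / b s = w at *
    norm_num at e
    generalize a s = a at *
    generalize b s = b at *
    generalize d s = d at *
    generalize β s = β at *
    refine (mul_eq_zero.mp (?_ : β * (a ^ 2 * b ^ 2 * d ^ 2) * _ = 0)).resolve_left
      (mul_ne_zero hβ (by positivity))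
    linear_combination b * e - 6 * β * b * (a ^ 4 + d ^ 4) * hF
      - H * a * d * (2 * a ^ 4 - 3 * a ^ 2 * d ^ 2 + 2 * d ^ 4) * hw
      + H * a * d * (2 * a ^ 4 - 3 * a ^ 2 * d ^ 2 + 2 * d ^ 4) * β
        * (a ^ 4 - a ^ 2 * d ^ 2 + d ^ 4) * hsq
      + 8 * β * a ^ 2 * d ^ 2 * b * (a ^ 4 - d ^ 4) * hsq
  have hE' : ∀ s ∈ S, H = 0 := by
    intro s hs
    have a2 := (da s hs).fun_pow 2
    have d2 := (dd s hs).fun_pow 2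
    have a4 := (da s hs).fun_pow 4
    have d4 := (dd s hs).fun_pow 4
    have e := key s hs hE
      (((((da s hs).fun_mul (dd s hs)).const_mul H).fun_mul
        (((a4.const_mul 4).fun_sub ((a2.fun_mul d2).const_mul 13)).fun_add
          (d4.const_mul 4))).fun_add
        (((db s hs).const_mul 8).fun_mul (a4.fun_sub d4)))
    have hE := hE s hs
    have hsq := hsq s hs
    have hb := hb s hs
    have ha := ha s hs
    have hd := hd s hs
    have hβ := hβ s hs
    have hw : b s * (β s * (a s ^ 6 + d s ^ 6) / b s) = β s * (a s ^ 6 + d s ^ 6) := by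
      field_simp
    generalize β s * (a s ^ 6 + d s ^ 6) / b s = w at *
    norm_num at e
    generalize a s = a at *
    generalize b s = b at *
    generalize d s = d at *
    generalize β s = β at *
    have hr : 0 < 2 * a ^ 4 - 3 * a ^ 2 * d ^ 2 + 2 * d ^ 4 := by
      nlinarith [sq_nonneg (a ^ 2 - d ^ 2), pow_pos ha 4, pow_pos hd 4]
    refine (mul_eq_zero.mp (?_ : β * (15 * a ^ 3 * d ^ 3 * b
      * (2 * a ^ 4 - 3 * a ^ 2 * d ^ 2 + 2 * d ^ 4)) * _ = 0)).resolve_left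
        (mul_ne_zero hβ (by positivity))
    linear_combination b * e - b * β * (5 * a ^ 4 - a ^ 2 * d ^ 2 + 5 * d ^ 4) * hE
      - 8 * (a ^ 4 - d ^ 4) * hw + 8 * β * (a ^ 4 - d ^ 4) * (a ^ 4 - a ^ 2 * d ^ 2 + d ^ 4) * hsq
  have hH := hE' t ht
  have e := hE t ht
  rw [hH] at e
  have ha := ha t ht
  have hb := hb t ht
  have hd := hd t ht
  have : 8 * b t * (a t ^ 2 + d t ^ 2) * (a t + d t) * (a t - d t) = 0 := by
    linear_combination e
  exact (mul_ne_zero (by positivity) (hne t ht)) this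

section Holonomic

variable {U : Set (Fin 3 → ℝ)} {v V : Fin 3 → (Fin 3 → ℝ) → ℝ} {c H : ℝ} {p : Fin 3 → ℝ}

lemma Hypo.differentiableAt_v (hyp : Hypo U v V c H) (hp : p ∈ U) (i : Fin 3) :
    DifferentiableAt ℝ (v i) p :=
  ((hyp.smooth_v i).contDiffAt (hyp.hopen.mem_nhds hp)).differentiableAt (by simp)

lemma Hypo.differentiableAt_V (hyp : Hypo U v V c H) (hp : p ∈ U) (i : Fin 3) :
    DifferentiableAt ℝ (V i) p :=
  ((hyp.smooth_V i).contDiffAt (hyp.hopen.mem_nhds hp)).differentiableAt (by simp)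

lemma Hypo.differentiableAt_pd (hyp : Hypo U v V c H) (hp : p ∈ U) (i j : Fin 3) :
    DifferentiableAt ℝ (pd j (v i)) p := by
  have h := ((hyp.smooth_v i).contDiffAt (hyp.hopen.mem_nhds hp)).fderiv_right
    (m := 1) (by norm_cast)
  exact (h.differentiableAt (by simp)).clm_apply (differentiableAt_const _)

lemma Hypo.differentiableAt_hh (hyp : Hypo U v V c H) (hp : p ∈ U) (i j : Fin 3) :
    DifferentiableAt ℝ (hh v i j) p := by
  have h : DifferentiableAt ℝ (fun q => 1 / v i q) p := by
    simpa using (hyp.differentiableAt_v hp i).fun_inv (hyp.pos i p hp).ne'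
  exact h.fun_mul (hyp.differentiableAt_pd hp j i)

lemma Hypo.curvature_zero (hyp : Hypo U v V c H) (hp : p ∈ U) :
    3 * (v 1 p * v 2 p) * V 0 p
      = -1 * v 1 p ^ 2 + -1 * v 2 p ^ 2 + H * (v 1 p * v 2 p * v 0 p) := by
  have h1 := hyp.pos 1 p hp
  have h2 := hyp.pos 2 p hp
  rw [hyp.ansatz_V1 p hp]
  field_simp
  ring

lemma Hypo.curvature_one (hyp : Hypo U v V c H) (hp : p ∈ U) :
    3 * (v 0 p * v 2 p) * V 1 p
      = -1 * v 0 p ^ 2 + 1 * v 2 p ^ 2 + H * (v 0 p * v 2 p * v 1 p) := by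
  have h0 := hyp.pos 0 p hp
  have h2 := hyp.pos 2 p hp
  rw [hyp.ansatz_V2 p hp]
  field_simp
  ring

lemma Hypo.curvature_two (hyp : Hypo U v V c H) (hp : p ∈ U) :
    3 * (v 0 p * v 1 p) * V 2 p
      = 1 * v 0 p ^ 2 + 1 * v 1 p ^ 2 + H * (v 0 p * v 1 p * v 2 p) := by
  have h0 := hyp.pos 0 p hp
  have h1 := hyp.pos 1 p hp
  rw [hyp.ansatz_V3 p hp]
  field_simp

lemma Hypo.pd_ansatz_v (hyp : Hypo U v V c H) (hp : p ∈ U) (j : Fin 3) :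
    v 1 p * pd j (v 1) p = v 0 p * pd j (v 0) p + v 2 p * pd j (v 2) p := by
  refine pd_sq_add_sq j (hyp.differentiableAt_v hp 0) (hyp.differentiableAt_v hp 1)
    (hyp.differentiableAt_v hp 2) ?_
  filter_upwards [hyp.hopen.mem_nhds hp] with q hq using hyp.ansatz_v q hq

lemma Hypo.pd_curvature_zero (hyp : Hypo U v V c H) (hp : p ∈ U) (j : Fin 3) :
    3 * (pd j (v 1) p * v 2 p + v 1 p * pd j (v 2) p) * V 0 p
        + 3 * (v 1 p * v 2 p) * pd j (V 0) p
      = 2 * (-1) * v 1 p * pd j (v 1) p + 2 * (-1) * v 2 p * pd j (v 2) p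
        + H * ((pd j (v 1) p * v 2 p + v 1 p * pd j (v 2) p) * v 0 p
          + v 1 p * v 2 p * pd j (v 0) p) :=
  pd_curvature j (hyp.differentiableAt_v hp 1) (hyp.differentiableAt_v hp 2)
    (hyp.differentiableAt_v hp 0) (hyp.differentiableAt_V hp 0)
    (by filter_upwards [hyp.hopen.mem_nhds hp] with q hq using hyp.curvature_zero hq)

lemma Hypo.pd_curvature_one (hyp : Hypo U v V c H) (hp : p ∈ U) (j : Fin 3) :
    3 * (pd j (v 0) p * v 2 p + v 0 p * pd j (v 2) p) * V 1 p
        + 3 * (v 0 p * v 2 p) * pd j (V 1) p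
      = 2 * (-1) * v 0 p * pd j (v 0) p + 2 * 1 * v 2 p * pd j (v 2) p
        + H * ((pd j (v 0) p * v 2 p + v 0 p * pd j (v 2) p) * v 1 p
          + v 0 p * v 2 p * pd j (v 1) p) :=
  pd_curvature j (hyp.differentiableAt_v hp 0) (hyp.differentiableAt_v hp 2)
    (hyp.differentiableAt_v hp 1) (hyp.differentiableAt_V hp 1)
    (by filter_upwards [hyp.hopen.mem_nhds hp] with q hq using hyp.curvature_one hq)

lemma Hypo.pd_zero_eq_zero (hyp : Hypo U v V c H) (hp : p ∈ U) (h : al v 0 p = 0) (i : Fin 3) :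
    pd 0 (v i) p = 0 := by
  have h1 : pd 0 (v 1) p = 0 := by simpa [al, (hyp.pos 1 p hp).ne'] using h
  have hV : pd 0 (V 1) p = 0 := by
    rw [hyp.holiv 1 0 (by decide) p hp]
    simp [hh, h1]
  have := derivs_eq_zero_of_middle (hyp.pos 0 p hp) (hyp.pos 2 p hp) (hyp.pd_ansatz_v hp 0) h1 hV
    (hyp.curvature_one hp) (hyp.pd_curvature_one hp 0)
  fin_cases i
  exacts [this.1, h1, this.2]

lemma Hypo.pd_two_eq_zero (hyp : Hypo U v V c H) (hp : p ∈ U) (h : al v 2 p = 0) (i : Fin 3) :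
    pd 2 (v i) p = 0 := by
  have h0 : pd 2 (v 0) p = 0 := by
    have h' : 1 / v 0 p * pd 2 (v 0) p = 0 := h
    simpa [(hyp.pos 0 p hp).ne'] using h'
  have hV : pd 2 (V 0) p = 0 := by
    rw [hyp.holiv 0 2 (by decide) p hp]
    simp [hh, h0]
  have := derivs_eq_zero_of_first (hyp.pos 0 p hp) (hyp.pos 1 p hp) (hyp.ansatz_v p hp)
    (hyp.pd_ansatz_v hp 2) h0 hV (hyp.curvature_zero hp) (hyp.pd_curvature_zero hp 2)
  fin_cases i
  exacts [h0, this.1, this.2]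

lemma Hypo.pd_one_relation (hyp : Hypo U v V c H) (hp : p ∈ U) :
    v 0 p ^ 5 * pd 1 (v 2) p = v 2 p ^ 5 * pd 1 (v 0) p := by
  refine pow_five_mul_deriv (hyp.ansatz_v p hp) (hyp.pd_ansatz_v hp 1) ?_ (hyp.curvature_zero hp) (hyp.curvature_one hp)
    (hyp.pd_curvature_zero hp 1)
  rw [hyp.holiv 0 1 (by decide) p hp, hh]
  have := hyp.pos 1 p hp
  field_simp

variable {W : Set (Fin 3 → ℝ)}

lemma Hypo.gauss_reduced (hyp : Hypo U v V c H) (hWo : IsOpen W) (hWU : W ⊆ U)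
    (h0 : ∀ p ∈ W, al v 0 p = 0) (h2 : ∀ p ∈ W, al v 2 p = 0) (hp : p ∈ W) :
    pd 1 (hh v 1 0) p + V 0 p * V 1 p + c * v 0 p * v 1 p = 0 ∧
    hh v 1 0 p * hh v 1 2 p + V 0 p * V 2 p + c * v 0 p * v 2 p = 0 ∧
    pd 1 (hh v 1 2) p + V 1 p * V 2 p + c * v 1 p * v 2 p = 0 := by
  have hz0 : ∀ i, ∀ q ∈ W, hh v 0 i q = 0 := fun i q hq => by
    simp [hh, hyp.pd_zero_eq_zero (hWU hq) (h0 q hq) i]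
  have hz2 : ∀ i, ∀ q ∈ W, hh v 2 i q = 0 := fun i q hq => by
    simp [hh, hyp.pd_two_eq_zero (hWU hq) (h2 q hq) i]
  have hd0 : ∀ i j, pd j (hh v 0 i) p = 0 := fun i j => pd_eq_zero_of_eventually j (by
    filter_upwards [hWo.mem_nhds hp] with q hq using hz0 i q hq)
  have hd2 : ∀ i j, pd j (hh v 2 i) p = 0 := fun i j => pd_eq_zero_of_eventually j (by
    filter_upwards [hWo.mem_nhds hp] with q hq using hz2 i q hq)
  have e1 := hyp.holiii 0 1 2 (by decide) (by decide) (by decide) p (hWU hp)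
  have e2 := hyp.holiii 0 2 1 (by decide) (by decide) (by decide) p (hWU hp)
  have e3 := hyp.holiii 1 2 0 (by decide) (by decide) (by decide) p (hWU hp)
  simp only [hd0, hd2, hz0 _ p hp, hz2 _ p hp] at e1 e2 e3
  exact ⟨by linarith, by linarith, by linarith⟩

lemma Hypo.exists_pd_one_ne_zero (hyp : Hypo U v V c H) (hWo : IsOpen W) (hWU : W ⊆ U)
    (hne : W.Nonempty) (h0 : ∀ p ∈ W, al v 0 p = 0) (h2 : ∀ p ∈ W, al v 2 p = 0) :
    ∃ p ∈ W, pd 1 (v 0) p ≠ 0 := by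
  by_contra! hcon
  obtain ⟨p, hp⟩ := hne
  have hpU := hWU hp
  have hz : ∀ q ∈ W, pd 1 (v 2) q = 0 := fun q hq => by
    have := hyp.pd_one_relation (hWU hq)
    rw [hcon q hq, mul_zero] at this
    exact (mul_eq_zero.mp this).resolve_left (pow_ne_zero 5 (hyp.pos 0 q (hWU hq)).ne')
  have d0 : pd 1 (hh v 1 0) p = 0 := pd_eq_zero_of_eventually 1 (by
    filter_upwards [hWo.mem_nhds hp] with q hq
    simp [hh, hcon q hq])
  have d2 : pd 1 (hh v 1 2) p = 0 := pd_eq_zero_of_eventually 1 (by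
    filter_upwards [hWo.mem_nhds hp] with q hq
    simp [hh, hz q hq])
  have hh0 : hh v 1 0 p = 0 := by simp [hh, hcon p hp]
  obtain ⟨e1, e2, e3⟩ := hyp.gauss_reduced hWo hWU h0 h2 hp
  rw [d0] at e1
  rw [hh0] at e2
  rw [d2] at e3
  have c0 := hyp.curvature_zero hpU
  have c1 := hyp.curvature_one hpU
  have c2 := hyp.curvature_two hpU
  refine not_products_eq (m := v 0 p * v 1 p * v 2 p) (c := c) (H := H) (hyp.pos 0 p hpU)
    (hyp.pos 1 p hpU) (hyp.pos 2 p hpU) (hyp.ansatz_v p hpU)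
    (p₁ := 3 * (v 1 p * v 2 p) * V 0 p) (p₂ := 3 * (v 0 p * v 2 p) * V 1 p)
    (p₃ := 3 * (v 0 p * v 1 p) * V 2 p)
    (by linear_combination c0) (by linear_combination c1) (by linear_combination c2) ?_ ?_ ?_
  · linear_combination (9 * v 0 p * v 1 p * v 2 p ^ 2) * e1
  · linear_combination (9 * v 0 p * v 1 p ^ 2 * v 2 p) * e2
  · linear_combination (9 * v 0 p ^ 2 * v 1 p * v 2 p) * e3

/-- The common value `β = ∂₂v₁ / v₁⁵ = ∂₂v₃ / v₃⁵`. -/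
def rate (v : Fin 3 → (Fin 3 → ℝ) → ℝ) (p : Fin 3 → ℝ) : ℝ :=
  pd 1 (v 0) p / v 0 p ^ 5

lemma Hypo.differentiableAt_rate (hyp : Hypo U v V c H) (hp : p ∈ U) :
    DifferentiableAt ℝ (rate v) p := by
  have h := (hyp.differentiableAt_pd hp 0 1).fun_mul
    (((hyp.differentiableAt_v hp 0).fun_pow 5).fun_inv (pow_ne_zero 5 (hyp.pos 0 p hp).ne'))
  simp only [← div_eq_mul_inv] at h
  exact h

lemma Hypo.pd_one_v_zero (hyp : Hypo U v V c H) (hp : p ∈ U) :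
    pd 1 (v 0) p = rate v p * v 0 p ^ 5 := by
  have := hyp.pos 0 p hp
  rw [rate]
  field_simp

lemma Hypo.pd_one_v_two (hyp : Hypo U v V c H) (hp : p ∈ U) :
    pd 1 (v 2) p = rate v p * v 2 p ^ 5 := by
  have h := hyp.pd_one_relation hp
  have := hyp.pos 0 p hp
  rw [rate]
  field_simp
  linarith

lemma Hypo.pd_one_v_one (hyp : Hypo U v V c H) (hp : p ∈ U) :
    pd 1 (v 1) p = rate v p * (v 0 p ^ 6 + v 2 p ^ 6) / v 1 p := by
  have h := hyp.pd_ansatz_v hp 1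
  rw [hyp.pd_one_v_zero hp, hyp.pd_one_v_two hp] at h
  rw [eq_div_iff (hyp.pos 1 p hp).ne']
  linear_combination h

lemma Hypo.pd_one_hh (hyp : Hypo U v V c H) (hp : p ∈ U) {i : Fin 3}
    (hi : ∀ q ∈ U, pd 1 (v i) q = rate v q * v i q ^ 5) :
    v 1 p ^ 3 * pd 1 (hh v 1 i) p = pd 1 (rate v) p * v i p ^ 5 * v 1 p ^ 2
      + 5 * rate v p ^ 2 * v i p ^ 9 * v 1 p ^ 2
      - rate v p ^ 2 * v i p ^ 5 * (v 0 p ^ 6 + v 2 p ^ 6) := by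
  have hev : ∀ᶠ q in 𝓝 p, hh v 1 i q * v 1 q = rate v q * v i q ^ 5 := by
    filter_upwards [hyp.hopen.mem_nhds hp] with q hq
    have := hyp.pos 1 q hq
    rw [hh, hi q hq]
    field_simp
  have e := ((hasDerivAt_line_zero 1 (hyp.differentiableAt_hh hp 1 i)).fun_mul
    (hasDerivAt_line_zero 1 (hyp.differentiableAt_v hp 1))).unique
    (((hasDerivAt_line_zero 1 (hyp.differentiableAt_rate hp)).fun_mul
      ((hasDerivAt_line_zero 1 (hyp.differentiableAt_v hp i)).fun_pow
        5)).congr_of_eventuallyEq (eventually_line 1 hev))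
  simp only [zero_smul, add_zero, hi p hp] at e
  have h0 := hev.self_of_nhds
  have h1 := hyp.pd_ansatz_v hp 1
  rw [hyp.pd_one_v_zero hp, hyp.pd_one_v_two hp] at h1
  norm_num at e
  linear_combination v 1 p ^ 2 * e - hh v 1 i p * v 1 p * h1
    - rate v p * (v 0 p ^ 6 + v 2 p ^ 6) * h0

lemma Hypo.algebraic_relation (hyp : Hypo U v V c H) (hWo : IsOpen W) (hWU : W ⊆ U)
    (h0 : ∀ p ∈ W, al v 0 p = 0) (h2 : ∀ p ∈ W, al v 2 p = 0) (hp : p ∈ W) :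
    (2 * H ^ 2 + 18 * c) * ((v 0 p ^ 2 - v 2 p ^ 2) * v 0 p ^ 2 * v 2 p ^ 2
        * (v 0 p ^ 2 + v 2 p ^ 2))
      + H * (v 0 p * v 1 p * v 2 p)
        * (2 * v 0 p ^ 4 - 3 * v 0 p ^ 2 * v 2 p ^ 2 + 2 * v 2 p ^ 4)
      - 4 * (v 0 p ^ 2 - v 2 p ^ 2) * (v 0 p ^ 2 + v 2 p ^ 2) ^ 2 = 0 := by
  have hpU := hWU hp
  obtain ⟨e1, e2, e3⟩ := hyp.gauss_reduced hWo hWU h0 h2 hp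
  have c0 := hyp.curvature_zero hpU
  have c1 := hyp.curvature_one hpU
  have c2 := hyp.curvature_two hpU
  have hb := hyp.pos 1 p hpU
  refine gauss_elimination (m := v 0 p * v 1 p * v 2 p) (hyp.pos 0 p hpU) hb (hyp.pos 2 p hpU)
    (hyp.ansatz_v p hpU) rfl
    (p₁ := 3 * (v 1 p * v 2 p) * V 0 p) (p₂ := 3 * (v 0 p * v 2 p) * V 1 p)
    (p₃ := 3 * (v 0 p * v 1 p) * V 2 p)
    (by linear_combination c0) (by linear_combination c1) (by linear_combination c2)
    (hyp.pd_one_hh hpU fun q hq => hyp.pd_one_v_zero hq)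
    (hyp.pd_one_hh hpU fun q hq => hyp.pd_one_v_two hq) ?_ ?_ ?_
  · linear_combination (9 * v 0 p * v 1 p * v 2 p ^ 2) * e1
  · have e : v 1 p ^ 2 * (hh v 1 0 p * hh v 1 2 p) = rate v p ^ 2 * v 0 p ^ 5 * v 2 p ^ 5 := by
      rw [hh, hh, hyp.pd_one_v_zero hpU, hyp.pd_one_v_two hpU]
      field_simp
    linear_combination (9 * v 0 p * v 1 p ^ 2 * v 2 p) * e2 - 9 * v 0 p * v 2 p * e
  · linear_combination (9 * v 0 p ^ 2 * v 1 p * v 2 p) * e3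

end Holonomic

theorem statement_6 (U : Set (Fin 3 → ℝ)) (v V : Fin 3 → (Fin 3 → ℝ) → ℝ) (c H : ℝ)
    (hyp : Hypo U v V c H) : ∀ W : Set (Fin 3 → ℝ), IsOpen W → W ⊆ U → W.Nonempty →
    ¬ (∀ p ∈ W, v 0 p - v 2 p ≠ 0 ∧ al v 0 p = 0 ∧ al v 2 p = 0) := by
  intro W hWo hWU hne hW
  have h0 : ∀ p ∈ W, al v 0 p = 0 := fun p hp => (hW p hp).2.1
  have h2 : ∀ p ∈ W, al v 2 p = 0 := fun p hp => (hW p hp).2.2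
  obtain ⟨p, hp, hp'⟩ := hyp.exists_pd_one_ne_zero hWo hWU hne h0 h2
  have hcont : ContinuousOn (pd 1 (v 0)) W := fun q hq =>
    (hyp.differentiableAt_pd (hWU hq) 0 1).continuousAt.continuousWithinAt
  have hopen : IsOpen (W ∩ pd 1 (v 0) ⁻¹' {0}ᶜ) :=
    hcont.isOpen_inter_preimage hWo isOpen_compl_singleton
  have hline : Continuous (fun s : ℝ => p + s • (Pi.single 1 1 : Fin 3 → ℝ)) := by fun_prop
  have hd : ∀ i (s : ℝ), p + s • (Pi.single 1 1 : Fin 3 → ℝ) ∈ W →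
      HasDerivAt (fun s : ℝ => v i (p + s • Pi.single 1 1))
        (pd 1 (v i) (p + s • Pi.single 1 1)) s :=
    fun i s hs => hasDerivAt_line (hyp.differentiableAt_v (hWU hs) i)
  refine no_nonconstant_reduced_solution (hopen.preimage hline) (t := 0)
    (a := fun s => v 0 (p + s • Pi.single 1 1)) (b := fun s => v 1 (p + s • Pi.single 1 1))
    (d := fun s => v 2 (p + s • Pi.single 1 1)) (β := fun s => rate v (p + s • Pi.single 1 1))
    (by simpa using ⟨hp, hp'⟩)
    (fun s hs => hyp.pos 0 _ (hWU hs.1)) (fun s hs => hyp.pos 1 _ (hWU hs.1))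
    (fun s hs => hyp.pos 2 _ (hWU hs.1)) (fun s hs => ?_) (fun s hs => (hW _ hs.1).1)
    (fun s hs => hyp.ansatz_v _ (hWU hs.1)) (fun s hs => ?_) (fun s hs => ?_) (fun s hs => ?_)
    (fun s hs => hyp.algebraic_relation hWo hWU h0 h2 hs.1)
  · exact div_ne_zero hs.2 (pow_ne_zero 5 (hyp.pos 0 _ (hWU hs.1)).ne')
  · simpa only [hyp.pd_one_v_zero (hWU hs.1)] using hd 0 s hs.1
  · simpa only [hyp.pd_one_v_one (hWU hs.1)] using hd 1 s hs.1
  · simpa only [hyp.pd_one_v_two (hWU hs.1)] using hd 2 s hs.1
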